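/- Let G be a finite group and let X and X' be G-modules. Then for any r, s ∈ ℤ, every natural transformation Φ : Ĥ^s(G, Hom_ℤ(X, −)) ⇒ Ĥ^{r+s}(G, Hom_ℤ(X', −)) of functors on G-modules is of the form Φ = (−∪x) for a unique x ∈ Ĥ^r(G, Hom_ℤ(X', X)), where the cup product is induced by composition of homomorphisms. -/

import Mathlib

/-!
This file sets up Tate cohomology of a finite group `G` (with coefficients in objects of
`Rep ℤ G`), realized concretely in each degree `n ∈ ℤ` as
`Ĥ^n(G, M) = Ĥ⁰(G, Hom_ℤ(J n, M))`, where `J n` is the standard `n`-th syzygy of the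
trivial module `ℤ` (the `n`-th tensor power of the augmentation ideal `I_G` for `n ≥ 0`,
and of its `ℤ`-linear dual for `n < 0`), and `Ĥ⁰` denotes invariants modulo norms.
Cup products are induced by the canonical comparison maps `J (i+j) ⟶ J i ⊗ J j`.
-/

open CategoryTheory MonoidalCategory TensorProduct

set_option linter.unusedSectionVars false
set_option maxHeartbeats 1000000

attribute [instance 0] AddCommGroup.toIntModule

namespace Enc

variable {k : Type} [CommRing k] {G : Type} [Group G] [Fintype G]

/-! ### Degree-zero Tate cohomology: invariants modulo norms -/

section Aux
variable {V V₂ : Type} [AddCommGroup V] [Module k V] [AddCommGroup V₂] [Module k V₂]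

/-- The norm map `v ↦ ∑_{g ∈ G} g • v` of a representation. -/
noncomputable def rnorm (ρ : Representation k G V) : V →ₗ[k] V := ∑ g : G, ρ g

lemma rnorm_mem_invariants (ρ : Representation k G V) (v : V) :
    rnorm ρ v ∈ ρ.invariants := by
  intro g
  show (ρ g) ((∑ h : G, ρ h) v) = _
  simp only [LinearMap.sum_apply, map_sum]
  rw [Fintype.sum_equiv (Equiv.mulLeft g) _ (fun h => ρ h v) (fun h => by
    rw [← Module.End.mul_apply, ← map_mul]; rfl)]
  simp [rnorm]

/-- The norm map, viewed as landing in the invariants. -/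
noncomputable def rnormRes (ρ : Representation k G V) : V →ₗ[k] ρ.invariants :=
  (rnorm ρ).codRestrict ρ.invariants (rnorm_mem_invariants ρ)

/-- The image of the norm map, inside the invariants. -/
noncomputable def rnormIm (ρ : Representation k G V) : Submodule k ρ.invariants :=
  LinearMap.range (rnormRes ρ)

/-- Degree-zero Tate cohomology of a representation: invariants modulo norms. -/
noncomputable def tate0 (ρ : Representation k G V) : Type :=
  ρ.invariants ⧸ rnormIm ρ

noncomputable instance (ρ : Representation k G V) : AddCommGroup (tate0 ρ) :=
  inferInstanceAs (AddCommGroup (ρ.invariants ⧸ rnormIm ρ))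

noncomputable instance (ρ : Representation k G V) : Module k (tate0 ρ) :=
  inferInstanceAs (Module k (ρ.invariants ⧸ rnormIm ρ))

/-- The Tate class of an invariant vector. -/
noncomputable def tate0mk {ρ : Representation k G V} (v : V) (hv : v ∈ ρ.invariants) :
    tate0 ρ := Submodule.Quotient.mk (⟨v, hv⟩ : ρ.invariants)

lemma invariants_comp {ρ : Representation k G V} {σ : Representation k G V₂}
    (f : V →ₗ[k] V₂) (hf : ∀ (g : G) (v : V), f (ρ g v) = σ g (f v)) :
    ∀ x ∈ ρ.invariants, f x ∈ σ.invariants := by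
  intro x hx g
  rw [← hf g x, hx g]

/-- Functoriality of degree-zero Tate cohomology along equivariant maps. -/
noncomputable def tate0map {ρ : Representation k G V} {σ : Representation k G V₂}
    (f : V →ₗ[k] V₂) (hf : ∀ (g : G) (v : V), f (ρ g v) = σ g (f v)) :
    tate0 ρ →ₗ[k] tate0 σ :=
  Submodule.mapQ (rnormIm ρ) (rnormIm σ) (f.restrict (invariants_comp f hf))
    (by
      rintro ⟨x, hx⟩ ⟨y, hy⟩
      refine ⟨f y, ?_⟩
      apply Subtype.ext
      have hy' := congrArg Subtype.val hy
      show rnorm σ (f y) = _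
      simp only [LinearMap.restrict_apply]
      have : rnorm σ (f y) = f (rnorm ρ y) := by
        simp only [rnorm, LinearMap.sum_apply, map_sum]
        exact Finset.sum_congr rfl fun g _ => (hf g y).symm
      rw [this]
      exact congrArg f hy')

end Aux

/-- Degree-zero Tate cohomology `Ĥ⁰(G, W) = W^G / N_G W` of an object of `Rep k G`. -/
noncomputable def H0T (W : Rep k G) : Type := tate0 W.ρ

noncomputable instance (W : Rep k G) : AddCommGroup (H0T W) :=
  inferInstanceAs (AddCommGroup (tate0 W.ρ))

noncomputable instance (W : Rep k G) : Module k (H0T W) :=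
  inferInstanceAs (Module k (tate0 W.ρ))

/-- Functoriality of `Ĥ⁰` along morphisms of representations. -/
noncomputable def H0Tmap {W W' : Rep k G} (ψ : W ⟶ W') : H0T W →ₗ[k] H0T W' :=
  tate0map ψ.hom (fun g v => Rep.hom_comm_apply ψ g v)

/-! ### The augmentation ideal and the syzygy modules `J n` -/

variable (G)

/-- The natural representation of `G` on `H →₀ k` for a `G`-set `H` (Mathlib's former
`Representation.ofMulAction`, which now lives on `MonoidAlgebra k H`). -/
noncomputable def ofMulAction (k : Type) [CommSemiring k] (G : Type) [Monoid G] (H : Type)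
    [MulAction G H] : Representation k G (H →₀ k) where
  toFun g := Finsupp.lmapDomain k k (g • ·)
  map_one' := by ext x y; simp
  map_mul' x y := by ext z w; simp [mul_smul]

/-- The augmentation map `ℤ[G] → ℤ`. -/
noncomputable def aug : (G →₀ ℤ) →ₗ[ℤ] ℤ :=
  Finsupp.linearCombination ℤ (fun _ : G => (1 : ℤ))

lemma aug_comm (g : G) (x : G →₀ ℤ) :
    aug G (ofMulAction ℤ G G g x) = aug G x := by
  unfold aug
  simp [ofMulAction, Finsupp.linearCombination_apply]
  rw [Finsupp.sum_mapDomain_index] <;> simp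

/-- The underlying `ℤ`-module of the augmentation ideal. -/
noncomputable abbrev IGcar : Type := LinearMap.ker (aug G)

/-- The representation of `G` on the augmentation ideal. -/
noncomputable def IGρ : Representation ℤ G (IGcar G) where
  toFun g := (ofMulAction ℤ G G g).restrict (p := LinearMap.ker (aug G))
    (q := LinearMap.ker (aug G)) (by
      intro x hx
      simp only [LinearMap.mem_ker] at hx ⊢
      rw [aug_comm]; exact hx)
  map_one' := by ext x; simp [LinearMap.restrict_apply]
  map_mul' g h := by ext x; simp [LinearMap.restrict_apply, Module.End.mul_apply]

/-- The augmentation ideal `I_G` of `ℤ[G]`, as an object of `Rep ℤ G`. -/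
noncomputable def IGrep : Rep ℤ G := Rep.of (IGρ G)

/-- `Hom_ℤ(X, A)` with the conjugation `G`-action, i.e. the internal hom in `Rep ℤ G`. -/
noncomputable abbrev hRep {G : Type} [Group G] (X A : Rep.{0} ℤ G) : Rep.{0} ℤ G :=
  (Rep.ihom X).obj A

/-- The `ℤ`-linear dual of the augmentation ideal, as an object of `Rep ℤ G`. -/
noncomputable def DIG : Rep ℤ G := hRep (IGrep G) (𝟙_ (Rep ℤ G))

instance : Module.Finite ℤ (IGcar G) := by
  have : Module.Finite ℤ (G →₀ ℤ) :=
    Module.Finite.equiv (Finsupp.linearEquivFunOnFinite ℤ ℤ G).symm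
  exact Module.Finite.of_injective (LinearMap.ker (aug G)).subtype Subtype.val_injective

instance : Module.Free ℤ (IGcar G) := by infer_instance

/-- Nonnegative tensor powers `I_G^{⊗ n}` (with `I_G^{⊗ 0} = ℤ`). -/
noncomputable def Jp : ℕ → Rep ℤ G
  | 0 => 𝟙_ (Rep ℤ G)
  | n + 1 => Jp n ⊗ IGrep G

/-- Tensor powers of the dual of the augmentation ideal. -/
noncomputable def Jn : ℕ → Rep ℤ G
  | 0 => 𝟙_ (Rep ℤ G)
  | n + 1 => Jn n ⊗ DIG G

/-- The standard syzygy modules of the trivial representation `ℤ`, indexed by `ℤ`: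
`J n = I_G^{⊗ n}` for `n ≥ 0`, and `J n = (I_G^∨)^{⊗ (-n)}` for `n < 0`. -/
noncomputable def J : ℤ → Rep ℤ G
  | .ofNat n => Jp G n
  | .negSucc n => Jn G (n + 1)

lemma J_ofNat (m : ℕ) : J G (m : ℤ) = Jp G m := rfl

lemma J_neg (m : ℕ) : J G (-(m : ℤ)) = Jn G m := by cases m <;> rfl

/-- The element of `(I_G)^∨ ⊗ I_G` corresponding to the identity map. -/
noncomputable def preElt : Module.Dual ℤ (IGcar G) ⊗[ℤ] IGcar G :=
  (dualTensorHomEquiv ℤ (IGcar G) (IGcar G)).symm LinearMap.id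

/-- The canonical element of `I_G ⊗ (I_G)^∨` corresponding to the identity map. -/
noncomputable def coevElt : (IGrep G ⊗ DIG G).V :=
  (TensorProduct.comm ℤ _ _) (preElt G)

lemma conj_dualTensor (g : G) (t : Module.Dual ℤ (IGcar G) ⊗[ℤ] IGcar G) :
    dualTensorHom ℤ _ _ (TensorProduct.map ((DIG G).ρ g) ((IGrep G).ρ g) t)
      = (IGrep G).ρ g ∘ₗ (dualTensorHom ℤ _ _ t) ∘ₗ (IGrep G).ρ g⁻¹ := by
  have key : ∀ {R : Type} [CommRing R] (V : Type) [AddCommGroup V] [Module R V] (a b : V →ₗ[R] V)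
      (d : Module.Dual R V →ₗ[R] Module.Dual R V) (_ : ∀ f, d f = f ∘ₗ b)
      (t : Module.Dual R V ⊗[R] V),
      dualTensorHom R V V (TensorProduct.map d a t) = a ∘ₗ (dualTensorHom R V V t) ∘ₗ b := by
    intro R _ V _ _ a b d hd t
    induction t with
    | zero => simp
    | tmul f v =>
        ext w
        simp only [TensorProduct.map_tmul, dualTensorHom_apply,
          LinearMap.comp_apply, hd]
        exact (map_smul a _ _).symm
    | add x y hx hy =>
        simp only [map_add, hx, hy, LinearMap.add_comp, LinearMap.comp_add]
  exact key (IGcar G) ((IGrep G).ρ g) ((IGrep G).ρ g⁻¹) ((DIG G).ρ g) (fun _ => rfl) t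

lemma coevElt_invariant (g : G) :
    ((IGrep G ⊗ DIG G).ρ g) (coevElt G) = coevElt G := by
  show TensorProduct.map ((IGrep G).ρ g) ((DIG G).ρ g)
      ((TensorProduct.comm ℤ _ _) (preElt G)) = _
  refine (TensorProduct.map_comm ((IGrep G).ρ g) ((DIG G).ρ g) (preElt G)).trans ?_
  show (TensorProduct.comm ℤ _ _) (TensorProduct.map ((DIG G).ρ g) ((IGrep G).ρ g) (preElt G))
      = (TensorProduct.comm ℤ _ _) (preElt G)
  refine congrArg (TensorProduct.comm ℤ _ _) ?_
  apply (dualTensorHomEquiv ℤ (IGcar G) (IGcar G)).injective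
  have h2 : dualTensorHom ℤ (IGcar G) (IGcar G) (preElt G) = LinearMap.id :=
    (dualTensorHomEquiv ℤ (IGcar G) (IGcar G)).apply_symm_apply LinearMap.id
  show dualTensorHom ℤ (IGcar G) (IGcar G)
      (TensorProduct.map ((DIG G).ρ g) ((IGrep G).ρ g) (preElt G))
    = dualTensorHom ℤ (IGcar G) (IGcar G) (preElt G)
  refine (conj_dualTensor G g (preElt G)).trans ?_
  show (IGrep G).ρ g ∘ₗ dualTensorHom ℤ (IGcar G) (IGcar G) (preElt G) ∘ₗ (IGrep G).ρ g⁻¹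
      = dualTensorHom ℤ (IGcar G) (IGcar G) (preElt G)
  rw [h2]
  apply LinearMap.ext
  intro v
  exact Representation.self_inv_apply (IGrep G).ρ g v

/-- The coevaluation `ℤ ⟶ I_G ⊗ I_G^∨`. -/
noncomputable def coev : 𝟙_ (Rep ℤ G) ⟶ IGrep G ⊗ DIG G := Rep.ofHom {
  toLinearMap := LinearMap.toSpanSingleton ℤ _ (coevElt G)
  isIntertwining' := by
    intro g
    apply LinearMap.ext
    intro z
    show LinearMap.toSpanSingleton ℤ _ (coevElt G) ((𝟙_ (Rep ℤ G)).ρ g z)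
        = ((IGrep G ⊗ DIG G).ρ g) (LinearMap.toSpanSingleton ℤ _ (coevElt G) z)
    have hz : ((𝟙_ (Rep ℤ G)).ρ g z) = z := rfl
    rw [hz]
    show z • coevElt G = ((IGrep G ⊗ DIG G).ρ g) (z • coevElt G)
    rw [map_smul, coevElt_invariant] }


variable {G}

/-- One-step comparison `J (n+1) ⟶ J n ⊗ I_G`. -/
noncomputable def sMap : ∀ n : ℤ, J G (n + 1) ⟶ J G n ⊗ IGrep G
  | .ofNat m => 𝟙 (Jp G m ⊗ IGrep G)
  | .negSucc 0 =>
      coev G ≫ (β_ (IGrep G) (DIG G)).hom ≫ ((λ_ (DIG G)).inv ▷ IGrep G)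
  | .negSucc (m+1) =>
      (ρ_ (Jn G (m+1))).inv ≫ (Jn G (m+1) ◁ (coev G ≫ (β_ (IGrep G) (DIG G)).hom))
        ≫ (α_ (Jn G (m+1)) (DIG G) (IGrep G)).inv

/-- One-step comparison `J (n-1) ⟶ J n ⊗ I_G^∨`. -/
noncomputable def tMap : ∀ n : ℤ, J G (n - 1) ⟶ J G n ⊗ DIG G
  | .ofNat 0 => 𝟙 (𝟙_ (Rep ℤ G) ⊗ DIG G)
  | .ofNat (m+1) =>
      eqToHom (congrArg (J G) (show (Int.ofNat (m+1)) - 1 = ((m:ℕ) : ℤ) by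
        rw [Int.ofNat_eq_coe]; push_cast; ring)) ≫
      (ρ_ (Jp G m)).inv ≫ (Jp G m ◁ coev G) ≫ (α_ (Jp G m) (IGrep G) (DIG G)).inv
  | .negSucc m => eqToHom (show J G (Int.negSucc m - 1) = J G (Int.negSucc m) ⊗ DIG G from rfl)

/-- Comparison maps `J (i + m) ⟶ J i ⊗ J m` for `m ≥ 0`. -/
noncomputable def μpos (i : ℤ) : ∀ m : ℕ, J G (i + m) ⟶ J G i ⊗ J G (m : ℤ)
  | 0 => eqToHom (congrArg (J G) (by omega)) ≫ (ρ_ (J G i)).inv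
  | m + 1 =>
      eqToHom (congrArg (J G) (show i + ((m:ℕ)+1:ℕ) = (i + m) + 1 by omega))
        ≫ sMap (i + m) ≫ (μpos i m ▷ IGrep G) ≫ (α_ (J G i) (J G (m:ℤ)) (IGrep G)).hom

/-- Comparison maps `J (i - m) ⟶ J i ⊗ J (-m)` for `m ≥ 0`. -/
noncomputable def μneg (i : ℤ) : ∀ m : ℕ, J G (i - m) ⟶ J G i ⊗ J G (-(m : ℤ))
  | 0 => eqToHom (congrArg (J G) (by omega)) ≫ (ρ_ (J G i)).inv
  | m + 1 =>
      eqToHom (congrArg (J G) (show i - ((m:ℕ)+1:ℕ) = (i - m) - 1 by omega))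
        ≫ tMap (i - m) ≫ (μneg i m ▷ DIG G) ≫ (α_ (J G i) (J G (-(m:ℤ))) (DIG G)).hom
        ≫ (J G i ◁ (eqToHom (show J G (-(m:ℤ)) ⊗ DIG G = J G (-((m:ℕ)+1:ℕ)) by
            rw [J_neg, J_neg]; rfl)))

variable (G)

/-- The canonical comparison map `J (i+j) ⟶ J i ⊗ J j`, implementing the standard stable
equivalences between the syzygies `J`; it induces the cup product on Tate cohomology. -/
noncomputable def μ (i : ℤ) : ∀ j : ℤ, J G (i + j) ⟶ J G i ⊗ J G j
  | .ofNat m => μpos i m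
  | .negSucc m =>
      eqToHom (congrArg (J G) (show i + Int.negSucc m = i - ((m+1 : ℕ) : ℤ) by
        rw [Int.negSucc_eq]; push_cast; ring))
        ≫ μneg i (m+1)

variable {G}

/-! ### Tate cohomology in all degrees, functoriality, cup products -/

/-- Tate cohomology `Ĥ^n(G, M)` of the finite group `G` with coefficients in `M : Rep ℤ G`,
realized as `Ĥ⁰(G, Hom_ℤ(J n, M))` for the standard `n`-th syzygy `J n` of `ℤ`. -/
noncomputable def tate (n : ℤ) (M : Rep ℤ G) : Type := H0T (hRep (J G n) M)

noncomputable instance (n : ℤ) (M : Rep ℤ G) : AddCommGroup (tate n M) :=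
  inferInstanceAs (AddCommGroup (H0T (hRep (J G n) M)))

/-- The map on Tate cohomology induced by a morphism of representations. -/
noncomputable def tmap (n : ℤ) {M N : Rep ℤ G} (φ : M ⟶ N) : tate n M → tate n N :=
  H0Tmap ((Rep.ihom (J G n)).map φ)

/-- Transport of Tate cohomology along an equality of degrees. -/
noncomputable def tcast {i j : ℤ} {M : Rep ℤ G} (h : i = j) (z : tate i M) : tate j M :=
  h ▸ z

lemma hom_invariant {X W : Rep.{0} ℤ G} (m : X ⟶ W) :
    m.hom.toLinearMap ∈ (hRep X W).ρ.invariants := by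
  intro g
  show W.ρ g ∘ₗ m.hom.toLinearMap ∘ₗ X.ρ g⁻¹ = m.hom.toLinearMap
  ext v
  simp only [LinearMap.comp_apply]
  exact (congrArg (W.ρ g) (Rep.hom_comm_apply m g⁻¹ v)).trans (W.ρ.self_inv_apply g _)

/-- The Tate cohomology class of a `G`-equivariant map `J n ⟶ W`. -/
noncomputable def mkCls {n : ℤ} {W : Rep ℤ G} (m : J G n ⟶ W) : tate n W :=
  tate0mk m.hom.toLinearMap (hom_invariant m)


lemma tensor_rho_eq (M N : Rep ℤ G) (g : G) :
    (M ⊗ N).ρ g = TensorProduct.map (M.ρ g) (N.ρ g) := rfl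

lemma cup_invariance {i j : ℤ} {M N : Rep ℤ G}
    (f : ((hRep (J G i) M).ρ.invariants))
    (g : ((hRep (J G j) N).ρ.invariants)) :
    (TensorProduct.map f.1 g.1).comp ((μ G i j).hom.toLinearMap)
      ∈ (hRep (J G (i + j)) (M ⊗ N)).ρ.invariants := by
  intro gg
  have hf : M.ρ gg ∘ₗ f.1 ∘ₗ (J G i).ρ gg⁻¹ = f.1 := f.2 gg
  have hg : N.ρ gg ∘ₗ g.1 ∘ₗ (J G j).ρ gg⁻¹ = g.1 := g.2 gg
  have hμ : (μ G i j).hom.toLinearMap.comp ((J G (i + j)).ρ gg⁻¹)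
      = (TensorProduct.map ((J G i).ρ gg⁻¹) ((J G j).ρ gg⁻¹)).comp (μ G i j).hom.toLinearMap := by
    exact (μ G i j).hom.isIntertwining' gg⁻¹
  have key : ∀ {A B C P Q : Type} [AddCommGroup A] [Module ℤ A] [AddCommGroup B] [Module ℤ B]
      [AddCommGroup C] [Module ℤ C] [AddCommGroup P] [Module ℤ P] [AddCommGroup Q] [Module ℤ Q]
      (p : P →ₗ[ℤ] P) (q : Q →ₗ[ℤ] Q) (u : A →ₗ[ℤ] P) (w : B →ₗ[ℤ] Q) (a : A →ₗ[ℤ] A)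
      (b : B →ₗ[ℤ] B) (c : C →ₗ[ℤ] C) (m : C →ₗ[ℤ] A ⊗[ℤ] B),
      m ∘ₗ c = TensorProduct.map a b ∘ₗ m →
      TensorProduct.map (p ∘ₗ u ∘ₗ a) (q ∘ₗ w ∘ₗ b) ∘ₗ m
        = TensorProduct.map p q ∘ₗ (TensorProduct.map u w ∘ₗ m) ∘ₗ c := by
    intro A B C P Q _ _ _ _ _ _ _ _ _ _ p q u w a b c m hm
    rw [LinearMap.comp_assoc, hm, TensorProduct.map_comp, TensorProduct.map_comp]
    rfl
  have h := key (M.ρ gg) (N.ρ gg) f.1 g.1 ((J G i).ρ gg⁻¹) ((J G j).ρ gg⁻¹)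
    ((J G (i + j)).ρ gg⁻¹) (μ G i j).hom.toLinearMap hμ
  rw [hf, hg] at h
  exact h.symm

lemma conj_term {i j : ℤ} {M N : Rep ℤ G} (u : (J G i).V →ₗ[ℤ] M.V)
    (w : (J G j).V →ₗ[ℤ] N.V) (h : G) :
    (TensorProduct.map (M.ρ h ∘ₗ u ∘ₗ (J G i).ρ h⁻¹) (N.ρ h ∘ₗ w ∘ₗ (J G j).ρ h⁻¹)).comp
        (μ G i j).hom.toLinearMap
      = ((hRep (J G (i + j)) (M ⊗ N)).ρ h) ((TensorProduct.map u w).comp (μ G i j).hom.toLinearMap) := by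
  have hμ : (μ G i j).hom.toLinearMap ∘ₗ (J G (i + j)).ρ h⁻¹
      = TensorProduct.map ((J G i).ρ h⁻¹) ((J G j).ρ h⁻¹) ∘ₗ (μ G i j).hom.toLinearMap := by
    exact (μ G i j).hom.isIntertwining' h⁻¹
  have key : ∀ {A B C P Q : Type} [AddCommGroup A] [Module ℤ A] [AddCommGroup B] [Module ℤ B]
      [AddCommGroup C] [Module ℤ C] [AddCommGroup P] [Module ℤ P] [AddCommGroup Q] [Module ℤ Q]
      (p : P →ₗ[ℤ] P) (q : Q →ₗ[ℤ] Q) (u : A →ₗ[ℤ] P) (w : B →ₗ[ℤ] Q) (a : A →ₗ[ℤ] A)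
      (b : B →ₗ[ℤ] B) (c : C →ₗ[ℤ] C) (m : C →ₗ[ℤ] A ⊗[ℤ] B),
      m ∘ₗ c = TensorProduct.map a b ∘ₗ m →
      TensorProduct.map (p ∘ₗ u ∘ₗ a) (q ∘ₗ w ∘ₗ b) ∘ₗ m
        = TensorProduct.map p q ∘ₗ (TensorProduct.map u w ∘ₗ m) ∘ₗ c := by
    intro A B C P Q _ _ _ _ _ _ _ _ _ _ p q u w a b c m hm
    rw [LinearMap.comp_assoc, hm, TensorProduct.map_comp, TensorProduct.map_comp]
    rfl
  exact key (M.ρ h) (N.ρ h) u w ((J G i).ρ h⁻¹) ((J G j).ρ h⁻¹)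
    ((J G (i + j)).ρ h⁻¹) (μ G i j).hom.toLinearMap hμ

lemma cup_norm_left {i j : ℤ} {M N : Rep ℤ G} (u : (J G i).V →ₗ[ℤ] M.V)
    (g : ((hRep (J G j) N).ρ.invariants)) :
    (TensorProduct.map (rnorm ((hRep (J G i) M).ρ) u) g.1).comp (μ G i j).hom.toLinearMap
      = rnorm ((hRep (J G (i + j)) (M ⊗ N)).ρ)
          ((TensorProduct.map u g.1).comp (μ G i j).hom.toLinearMap) := by
  have h1 : rnorm ((hRep (J G i) M).ρ) u = ∑ h : G, ((hRep (J G i) M).ρ h) u := by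
    exact LinearMap.sum_apply _ _ _
  have h2 : rnorm ((hRep (J G (i + j)) (M ⊗ N)).ρ) ((TensorProduct.map u g.1).comp (μ G i j).hom.toLinearMap)
      = ∑ h : G, ((hRep (J G (i + j)) (M ⊗ N)).ρ h)
          ((TensorProduct.map u g.1).comp (μ G i j).hom.toLinearMap) := by
    exact LinearMap.sum_apply _ _ _
  have h3 : ∀ {R : Type} [CommRing R] {A B C P Q : Type} [AddCommGroup A] [Module R A] [AddCommGroup B] [Module R B]
      [AddCommGroup C] [Module R C] [AddCommGroup P] [Module R P] [AddCommGroup Q] [Module R Q]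
      (u : G → A →ₗ[R] P) (w : B →ₗ[R] Q) (m : C →ₗ[R] A ⊗[R] B),
      TensorProduct.map (∑ h : G, u h) w ∘ₗ m = ∑ h : G, TensorProduct.map (u h) w ∘ₗ m := by
    intro R _ A B C P Q _ _ _ _ _ _ _ _ _ _ u w m
    have e : TensorProduct.map (∑ h : G, u h) w = ∑ h : G, TensorProduct.map (u h) w := by
      ext x y
      simp [TensorProduct.sum_tmul, LinearMap.sum_apply]
    rw [e]
    ext x
    simp [LinearMap.sum_apply]
  rw [h1, h2]
  refine (h3 (fun h => ((hRep (J G i) M).ρ h) u) g.1 (μ G i j).hom.toLinearMap).trans ?_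
  refine Finset.sum_congr rfl fun h _ => ?_
  have hginv : N.ρ h ∘ₗ g.1 ∘ₗ (J G j).ρ h⁻¹ = g.1 := g.2 h
  have hc := conj_term u g.1 h
  rw [hginv] at hc
  exact hc

lemma cup_norm_right {i j : ℤ} {M N : Rep ℤ G}
    (f : ((hRep (J G i) M).ρ.invariants)) (w : (J G j).V →ₗ[ℤ] N.V) :
    (TensorProduct.map f.1 (rnorm ((hRep (J G j) N).ρ) w)).comp (μ G i j).hom.toLinearMap
      = rnorm ((hRep (J G (i + j)) (M ⊗ N)).ρ)
          ((TensorProduct.map f.1 w).comp (μ G i j).hom.toLinearMap) := by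
  have h1 : rnorm ((hRep (J G j) N).ρ) w = ∑ h : G, ((hRep (J G j) N).ρ h) w := by
    exact LinearMap.sum_apply _ _ _
  have h2 : rnorm ((hRep (J G (i + j)) (M ⊗ N)).ρ) ((TensorProduct.map f.1 w).comp (μ G i j).hom.toLinearMap)
      = ∑ h : G, ((hRep (J G (i + j)) (M ⊗ N)).ρ h)
          ((TensorProduct.map f.1 w).comp (μ G i j).hom.toLinearMap) := by
    exact LinearMap.sum_apply _ _ _
  have h3 : ∀ {R : Type} [CommRing R] {A B C P Q : Type} [AddCommGroup A] [Module R A] [AddCommGroup B] [Module R B]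
      [AddCommGroup C] [Module R C] [AddCommGroup P] [Module R P] [AddCommGroup Q] [Module R Q]
      (u : A →ₗ[R] P) (w : G → B →ₗ[R] Q) (m : C →ₗ[R] A ⊗[R] B),
      TensorProduct.map u (∑ h : G, w h) ∘ₗ m = ∑ h : G, TensorProduct.map u (w h) ∘ₗ m := by
    intro R _ A B C P Q _ _ _ _ _ _ _ _ _ _ u w m
    have e : TensorProduct.map u (∑ h : G, w h) = ∑ h : G, TensorProduct.map u (w h) := by
      ext x y
      simp [TensorProduct.tmul_sum, LinearMap.sum_apply]
    rw [e]
    ext x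
    simp [LinearMap.sum_apply]
  rw [h1, h2]
  refine (h3 f.1 (fun h => ((hRep (J G j) N).ρ h) w) (μ G i j).hom.toLinearMap).trans ?_
  refine Finset.sum_congr rfl fun h _ => ?_
  have hfinv : M.ρ h ∘ₗ f.1 ∘ₗ (J G i).ρ h⁻¹ = f.1 := f.2 h
  have hc := conj_term f.1 w h
  rw [hfinv] at hc
  exact hc

lemma cup_welldef {i j : ℤ} {M N : Rep ℤ G}
    (a₁ : ((hRep (J G i) M).ρ.invariants)) (b₁ : ((hRep (J G j) N).ρ.invariants))
    (a₂ : ((hRep (J G i) M).ρ.invariants)) (b₂ : ((hRep (J G j) N).ρ.invariants))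
    (ha : a₁ - a₂ ∈ rnormIm ((hRep (J G i) M).ρ))
    (hb : b₁ - b₂ ∈ rnormIm ((hRep (J G j) N).ρ)) :
    tate0mk (ρ := (hRep (J G (i + j)) (M ⊗ N)).ρ)
          ((TensorProduct.map a₁.1 b₁.1).comp ((μ G i j).hom.toLinearMap)) (cup_invariance a₁ b₁)
      = tate0mk (ρ := (hRep (J G (i + j)) (M ⊗ N)).ρ)
          ((TensorProduct.map a₂.1 b₂.1).comp ((μ G i j).hom.toLinearMap)) (cup_invariance a₂ b₂) := by
  obtain ⟨u, hu⟩ := ha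
  obtain ⟨w, hw⟩ := hb
  have hu' : rnorm ((hRep (J G i) M).ρ) u = a₁.1 - a₂.1 := congrArg Subtype.val hu
  have hw' : rnorm ((hRep (J G j) N).ρ) w = b₁.1 - b₂.1 := congrArg Subtype.val hw
  have step1 : tate0mk (ρ := (hRep (J G (i + j)) (M ⊗ N)).ρ)
          ((TensorProduct.map a₁.1 b₁.1).comp ((μ G i j).hom.toLinearMap))
        (cup_invariance a₁ b₁)
      = tate0mk (ρ := (hRep (J G (i + j)) (M ⊗ N)).ρ)
          ((TensorProduct.map a₂.1 b₁.1).comp ((μ G i j).hom.toLinearMap)) (cup_invariance a₂ b₁) := by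
    refine (Submodule.Quotient.eq _).mpr ?_
    refine ⟨(TensorProduct.map u b₁.1).comp ((μ G i j).hom.toLinearMap), ?_⟩
    apply Subtype.ext
    have key := cup_norm_left u b₁
    rw [hu'] at key
    refine key.symm.trans ?_
    have hsub : ∀ {R : Type} [CommRing R] {A B C P Q : Type} [AddCommGroup A] [Module R A] [AddCommGroup B] [Module R B]
        [AddCommGroup C] [Module R C] [AddCommGroup P] [Module R P] [AddCommGroup Q] [Module R Q]
        (u u' : A →ₗ[R] P) (w : B →ₗ[R] Q) (m : C →ₗ[R] A ⊗[R] B),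
        TensorProduct.map (u - u') w ∘ₗ m
          = TensorProduct.map u w ∘ₗ m - TensorProduct.map u' w ∘ₗ m := by
      intro R _ A B C P Q _ _ _ _ _ _ _ _ _ _ u u' w m
      rw [← LinearMap.sub_comp]
      congr 1
      ext x y
      simp [TensorProduct.sub_tmul]
    exact hsub a₁.1 a₂.1 b₁.1 (μ G i j).hom.toLinearMap
  have step2 : tate0mk (ρ := (hRep (J G (i + j)) (M ⊗ N)).ρ)
          ((TensorProduct.map a₂.1 b₁.1).comp ((μ G i j).hom.toLinearMap))
        (cup_invariance a₂ b₁)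
      = tate0mk (ρ := (hRep (J G (i + j)) (M ⊗ N)).ρ)
          ((TensorProduct.map a₂.1 b₂.1).comp ((μ G i j).hom.toLinearMap)) (cup_invariance a₂ b₂) := by
    refine (Submodule.Quotient.eq _).mpr ?_
    refine ⟨(TensorProduct.map a₂.1 w).comp ((μ G i j).hom.toLinearMap), ?_⟩
    apply Subtype.ext
    have key := cup_norm_right a₂ w
    rw [hw'] at key
    refine key.symm.trans ?_
    have hsub : ∀ {R : Type} [CommRing R] {A B C P Q : Type} [AddCommGroup A] [Module R A] [AddCommGroup B] [Module R B]
        [AddCommGroup C] [Module R C] [AddCommGroup P] [Module R P] [AddCommGroup Q] [Module R Q]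
        (u : A →ₗ[R] P) (w w' : B →ₗ[R] Q) (m : C →ₗ[R] A ⊗[R] B),
        TensorProduct.map u (w - w') ∘ₗ m
          = TensorProduct.map u w ∘ₗ m - TensorProduct.map u w' ∘ₗ m := by
      intro R _ A B C P Q _ _ _ _ _ _ _ _ _ _ u w w' m
      rw [← LinearMap.sub_comp]
      congr 1
      ext x y
      simp [TensorProduct.tmul_sub]
    exact hsub a₂.1 b₁.1 b₂.1 (μ G i j).hom.toLinearMap
  exact step1.trans step2

/-- The cup product `Ĥ^i(G, M) × Ĥ^j(G, N) → Ĥ^{i+j}(G, M ⊗ N)` on Tate cohomology,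
induced by the comparison maps `μ`. -/
noncomputable def cup {i j : ℤ} {M N : Rep ℤ G} (z₁ : tate i M) (z₂ : tate j N) :
    tate (i + j) (M ⊗ N) :=
  Quotient.liftOn₂ z₁ z₂
    (fun f g => tate0mk ((TensorProduct.map f.1 g.1).comp ((μ G i j).hom.toLinearMap)) (cup_invariance f g))
    (fun a₁ b₁ a₂ b₂ ha hb => cup_welldef a₁ b₁ a₂ b₂
      ((Submodule.quotientRel_def _).mp ha) ((Submodule.quotientRel_def _).mp hb))

/-! ### Pairings -/

/-- The composition pairing `Hom_ℤ(B, C) ⊗ Hom_ℤ(A, B) ⟶ Hom_ℤ(A, C)`, `f ⊗ φ ↦ f ∘ φ`. -/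
noncomputable def compPair (A B C : Rep ℤ G) : hRep B C ⊗ hRep A B ⟶ hRep A C :=
  MonoidalClosed.curry <|
    (A ◁ (β_ (hRep B C) (hRep A B)).hom) ≫ (α_ A (hRep A B) (hRep B C)).inv
      ≫ (((ihom.ev A).app B) ▷ hRep B C) ≫ (ihom.ev B).app C

/-- The evaluation pairing `Hom_ℤ(X, B) ⊗ X ⟶ B`, `f ⊗ x ↦ f x`. -/
noncomputable def evPair (X B : Rep ℤ G) : hRep X B ⊗ X ⟶ B :=
  (β_ (hRep X B) X).hom ≫ (ihom.ev X).app B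

/-- The cup product `Ĥ^i(G, Hom(X, A)) × Ĥ^j(G, Hom(X', X)) → Ĥ^{i+j}(G, Hom(X', A))`
induced by the composition pairing. -/
noncomputable def ccup {i j : ℤ} {X X' A : Rep ℤ G}
    (z : tate i (hRep X A)) (x : tate j (hRep X' X)) : tate (i + j) (hRep X' A) :=
  tmap (i + j) (compPair X' X A) (cup z x)

/-- `ccup`, with the degree of the target adjusted along an equality of integers. -/
noncomputable def ccupTo {i j m : ℤ} {X X' A : Rep ℤ G}
    (z : tate i (hRep X A)) (x : tate j (hRep X' X)) (h : i + j = m) :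
    tate m (hRep X' A) :=
  tcast h (ccup z x)

/-- The class of the identity in `Ĥ⁰(G, Hom_ℤ(X, X))`. -/
noncomputable def idCls (X : Rep ℤ G) : tate 0 (hRep X X) :=
  mkCls (MonoidalClosed.curry (ρ_ X).hom)

/-! ### Encoding pairs and related notions -/

/-- `(X, X')` is an *`r`-encoding pair* if for some `i ∈ ℤ` there is a natural isomorphism
of functors `Ĥ^i(G, Hom_ℤ(X, -)) ≅ Ĥ^{i+r}(G, Hom_ℤ(X', -))` on `Rep ℤ G`. -/
def IsEncodingPair {G : Type} [Group G] [Fintype G] (r : ℤ) (X X' : Rep ℤ G) : Prop :=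
  ∃ (i : ℤ) (e : ∀ A : Rep ℤ G, tate i (hRep X A) ≃+ tate (i + r) (hRep X' A)),
    ∀ {A B : Rep ℤ G} (φ : A ⟶ B) (z : tate i (hRep X A)),
      e B (tmap i ((Rep.ihom X).map φ) z) = tmap (i + r) ((Rep.ihom X').map φ) (e A z)

/-- `x ∈ Ĥ^r(G, Hom_ℤ(X', X))` is an *encoding element* for the pair `(X, X')` if it has a
*decoding element* `x' ∈ Ĥ^{-r}(G, Hom_ℤ(X, X'))` with `x' ∪ x = [id_{X'}]` and
`x ∪ x' = [id_X]`. -/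
def IsEncodingElement {G : Type} [Group G] [Fintype G] {r : ℤ} (X X' : Rep ℤ G)
    (x : tate r (hRep X' X)) : Prop :=
  ∃ x' : tate (-r) (hRep X X'),
    ccupTo x' x (by ring) = idCls X' ∧ ccupTo x x' (by ring) = idCls X

/-- The induced `G`-module `ℤ[G] ⊗_ℤ A ≅ (G →₀ A)`, with `G` acting by left translation. -/
noncomputable def indRep (G : Type) [Group G] (A : Type) [AddCommGroup A] [Module ℤ A] :
    Rep ℤ G :=
  Rep.of (G := G) (X := G →₀ A)
    { toFun := fun g => Finsupp.lmapDomain A ℤ (fun h => g * h)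
      map_one' := by
        ext x h
        simp [Finsupp.lmapDomain_apply, Finsupp.mapDomain_id, one_mul]
      map_mul' := fun g g' => by
        ext x h
        simp [Finsupp.lmapDomain_apply, Module.End.mul_apply, Finsupp.mapDomain_single,
          mul_assoc] }

/-- A `G`-module is *induced* if it is isomorphic to `ℤ[G] ⊗_ℤ A` for some abelian group `A`. -/
def IsInduced {G : Type} [Group G] (M : Rep ℤ G) : Prop :=
  ∃ (A : Type) (_ : AddCommGroup A) (_ : Module ℤ A), Nonempty (M ≅ indRep G A)

/-- A class `φ ∈ Ĥ⁰(G, Hom_ℤ(X, X))` is a unit for the (composition) cup product. -/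
def IsUnitCls {G : Type} [Group G] [Fintype G] {X : Rep ℤ G}
    (φ : tate 0 (hRep X X)) : Prop :=
  ∃ ψ : tate 0 (hRep X X),
    ccupTo φ ψ (by ring) = idCls X ∧ ccupTo ψ φ (by ring) = idCls X


/-- The natural map `Hom_ℤ(X, A) ⊗ I_G ⟶ Hom_ℤ(X, A ⊗ I_G)`, `f ⊗ z ↦ (x ↦ f x ⊗ z)`. -/
noncomputable def pr0 (X A : Rep ℤ G) : hRep X A ⊗ IGrep G ⟶ hRep X (A ⊗ IGrep G) :=
  MonoidalClosed.curry ((α_ X (hRep X A) (IGrep G)).inv ≫ ((ihom.ev X).app A ▷ IGrep G))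

/-- The natural evaluation map `Hom_ℤ(X, Hom_ℤ(I_G, A)) ⊗ I_G ⟶ Hom_ℤ(X, A)`,
`f ⊗ z ↦ (x ↦ f x z)`. -/
noncomputable def pr1 (X A : Rep ℤ G) :
    hRep X (hRep (IGrep G) A) ⊗ IGrep G ⟶ hRep X A :=
  MonoidalClosed.curry ((α_ X (hRep X (hRep (IGrep G) A)) (IGrep G)).inv
    ≫ ((ihom.ev X).app (hRep (IGrep G) A) ▷ IGrep G) ≫ evPair (IGrep G) A)

/-- The natural evaluation map `Hom_ℤ(X', X) ⊗ (X' ⊗ A) ⟶ X ⊗ A`. -/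
noncomputable def tPair (X' X A : Rep ℤ G) : hRep X' X ⊗ (X' ⊗ A) ⟶ X ⊗ A :=
  (α_ (hRep X' X) X' A).inv ≫ (evPair X' X ▷ A)

/-- A functor `Rep ℤ G ⥤ Rep ℤ G` sends `ℤ`-split short exact sequences of `G`-modules to
short exact sequences of `G`-modules. -/
def PreservesZSplitSES {G : Type} [Group G] (F : Rep.{0} ℤ G ⥤ Rep.{0} ℤ G) : Prop :=
  ∀ (A B C : Rep.{0} ℤ G) (f : A ⟶ B) (g : B ⟶ C),
    Function.Injective f.hom → Function.Surjective g.hom → Function.Exact f.hom g.hom →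
    (∃ s : C.V →+ B.V, ∀ x, g.hom (s x) = x) →
    Function.Injective (F.map f).hom ∧ Function.Surjective (F.map g).hom ∧
      Function.Exact (F.map f).hom (F.map g).hom

/-- A *shiftable functor*: it sends `ℤ`-split short exact sequences of `G`-modules to short
exact sequences, and sends induced modules to induced modules. -/
def Shiftable {G : Type} [Group G] (F : Rep.{0} ℤ G ⥤ Rep.{0} ℤ G) : Prop :=
  PreservesZSplitSES F ∧ ∀ M : Rep ℤ G, IsInduced M → IsInduced (F.obj M)

end Enc

open CategoryTheory MonoidalCategory TensorProduct

namespace Enc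

section Stable
variable {k : Type} [CommRing k] {G : Type} [Group G] [Fintype G]

/-- A morphism of representations which is the norm of a linear map. -/
def Nrm {A B : Rep.{0} k G} (f : A ⟶ B) : Prop :=
  ∃ h : A.V →ₗ[k] B.V, ∀ v : A.V, f.hom v = ∑ g : G, B.ρ g (h (A.ρ g⁻¹ v))

lemma Nrm.add {A B : Rep.{0} k G} {f f' : A ⟶ B} (h : Nrm f) (h' : Nrm f') : Nrm (f + f') := by
  obtain ⟨u, hu⟩ := h
  obtain ⟨w, hw⟩ := h'
  refine ⟨u + w, fun v => ?_⟩
  simp [Rep.add_hom, hu, hw, Finset.sum_add_distrib]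

lemma Nrm.neg {A B : Rep.{0} k G} {f : A ⟶ B} (h : Nrm f) : Nrm (-f) := by
  obtain ⟨u, hu⟩ := h
  refine ⟨-u, fun v => ?_⟩
  simp [Rep.neg_hom, hu]

lemma Nrm.zero {A B : Rep.{0} k G} : Nrm (0 : A ⟶ B) := by
  refine ⟨0, fun v => ?_⟩
  simp [Rep.zero_hom]

lemma Nrm.sub {A B : Rep.{0} k G} {f f' : A ⟶ B} (h : Nrm f) (h' : Nrm f') : Nrm (f - f') := by
  rw [sub_eq_add_neg]; exact h.add h'.neg

lemma Nrm.comp_right {A B C : Rep.{0} k G} {f : A ⟶ B} (h : Nrm f) (p : B ⟶ C) :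
    Nrm (f ≫ p) := by
  obtain ⟨u, hu⟩ := h
  refine ⟨p.hom.toLinearMap ∘ₗ u, fun v => ?_⟩
  have : (f ≫ p).hom v = p.hom (f.hom v) := rfl
  rw [this, hu, map_sum]
  exact Finset.sum_congr rfl fun g _ => Rep.hom_comm_apply p g _

lemma Nrm.comp_left {A B C : Rep.{0} k G} {f : B ⟶ C} (h : Nrm f) (p : A ⟶ B) :
    Nrm (p ≫ f) := by
  obtain ⟨u, hu⟩ := h
  refine ⟨u ∘ₗ p.hom.toLinearMap, fun v => ?_⟩
  have : (p ≫ f).hom v = f.hom (p.hom v) := rfl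
  rw [this, hu]
  exact Finset.sum_congr rfl fun g _ =>
    congrArg (fun w => C.ρ g (u w)) (Rep.hom_comm_apply p g⁻¹ v).symm

lemma Nrm.whiskerLeft {A B : Rep.{0} k G} {f : A ⟶ B} (h : Nrm f) (K : Rep.{0} k G) :
    Nrm (K ◁ f) := by
  obtain ⟨u, hu⟩ := h
  refine ⟨LinearMap.lTensor K.V u, fun v => ?_⟩
  induction v using TensorProduct.induction_on with
  | zero => simp
  | add x y hx hy =>
    simp only [map_add, hx, hy, Finset.sum_add_distrib]
  | tmul x y =>
    have e1 : (K ◁ f).hom (x ⊗ₜ[k] y) = x ⊗ₜ[k] (f.hom y) := rfl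
    refine e1.trans ?_
    rw [hu, TensorProduct.tmul_sum]
    refine Finset.sum_congr rfl fun g _ => ?_
    have e2 : ((K ⊗ B).ρ g) ((LinearMap.lTensor K.V u) (((K ⊗ A).ρ g⁻¹) (x ⊗ₜ[k] y)))
      = (K.ρ g (K.ρ g⁻¹ x)) ⊗ₜ[k] (B.ρ g (u (A.ρ g⁻¹ y))) := rfl
    rw [e2, Representation.self_inv_apply]

/-- Stable equivalence of morphisms. -/
def Seq {A B : Rep.{0} k G} (f f' : A ⟶ B) : Prop := Nrm (f - f')

lemma Seq.refl {A B : Rep.{0} k G} (f : A ⟶ B) : Seq f f := by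
  unfold Seq; rw [sub_self]; exact Nrm.zero

lemma Seq.of_eq {A B : Rep.{0} k G} {f f' : A ⟶ B} (h : f = f') : Seq f f' := h ▸ Seq.refl f

lemma Seq.symm {A B : Rep.{0} k G} {f f' : A ⟶ B} (h : Seq f f') : Seq f' f := by
  unfold Seq; rw [← neg_sub]; exact h.neg

lemma Seq.trans {A B : Rep.{0} k G} {f f' f'' : A ⟶ B} (h : Seq f f') (h' : Seq f' f'') :
    Seq f f'' := by
  unfold Seq; rw [← sub_add_sub_cancel f f' f'']; exact Nrm.add h h'

lemma Seq.comp {A B C : Rep.{0} k G} {f f' : A ⟶ B} {p p' : B ⟶ C} (h : Seq f f')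
    (h' : Seq p p') : Seq (f ≫ p) (f' ≫ p') := by
  have : f ≫ p - f' ≫ p' = (f - f') ≫ p + f' ≫ (p - p') := by
    rw [Preadditive.sub_comp, Preadditive.comp_sub]; abel
  unfold Seq; rw [this]
  exact (Nrm.comp_right h p).add (Nrm.comp_left h' f')

lemma Seq.comp_left {A B C : Rep.{0} k G} (f : A ⟶ B) {p p' : B ⟶ C}
    (h' : Seq p p') : Seq (f ≫ p) (f ≫ p') := (Seq.refl f).comp h'

lemma Seq.comp_right {A B C : Rep.{0} k G} {f f' : A ⟶ B} (h : Seq f f')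
    (p : B ⟶ C) : Seq (f ≫ p) (f' ≫ p) := h.comp (Seq.refl p)

lemma Seq.whiskerLeft {A B : Rep.{0} k G} {f f' : A ⟶ B} (h : Seq f f') (K : Rep.{0} k G) :
    Seq (K ◁ f) (K ◁ f') := by
  have : K ◁ f - K ◁ f' = K ◁ (f - f') := by
    rw [sub_eq_add_neg, sub_eq_add_neg, MonoidalPreadditive.whiskerLeft_add]
    congr 1
    rw [eq_comm, eq_neg_iff_add_eq_zero, ← MonoidalPreadditive.whiskerLeft_add]; simp
  unfold Seq; rw [this]; exact Nrm.whiskerLeft h K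

lemma Seq.whiskerRight {A B : Rep.{0} k G} {f f' : A ⟶ B} (h : Seq f f') (K : Rep.{0} k G) :
    Seq (f ▷ K) (f' ▷ K) := by
  have e : ∀ f : A ⟶ B, f ▷ K = (β_ A K).hom ≫ (K ◁ f) ≫ (β_ B K).inv := by
    intro f; simp
  rw [e, e]
  exact ((h.whiskerLeft K).comp_right _).comp_left _

/-- Stable isomorphisms. -/
def SI {A B : Rep.{0} k G} (f : A ⟶ B) : Prop :=
  ∃ f' : B ⟶ A, Seq (f ≫ f') (𝟙 A) ∧ Seq (f' ≫ f) (𝟙 B)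

lemma SI.of_isIso {A B : Rep.{0} k G} (f : A ⟶ B) [IsIso f] : SI f :=
  ⟨inv f, Seq.of_eq (by simp), Seq.of_eq (by simp)⟩

lemma SI.comp {A B C : Rep.{0} k G} {f : A ⟶ B} {p : B ⟶ C} (h : SI f) (h' : SI p) :
    SI (f ≫ p) := by
  obtain ⟨f', h1, h2⟩ := h
  obtain ⟨p', h3, h4⟩ := h'
  refine ⟨p' ≫ f', ?_, ?_⟩
  · have := ((h3.comp_right f').comp_left f)
    simp only [Category.id_comp, Category.assoc] at this ⊢
    exact this.trans h1
  · have := ((h2.comp_right p).comp_left p')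
    simp only [Category.id_comp, Category.assoc] at this ⊢
    exact this.trans h4

lemma SI.whiskerLeft {A B : Rep.{0} k G} {f : A ⟶ B} (h : SI f) (K : Rep.{0} k G) :
    SI (K ◁ f) := by
  obtain ⟨f', h1, h2⟩ := h
  refine ⟨K ◁ f', ?_, ?_⟩
  · have := h1.whiskerLeft K
    simpa using this
  · have := h2.whiskerLeft K
    simpa using this

lemma SI.whiskerRight {A B : Rep.{0} k G} {f : A ⟶ B} (h : SI f) (K : Rep.{0} k G) :
    SI (f ▷ K) := by
  obtain ⟨f', h1, h2⟩ := h
  refine ⟨f' ▷ K, ?_, ?_⟩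
  · have := h1.whiskerRight K
    simpa using this
  · have := h2.whiskerRight K
    simpa using this

/-- Cancellation of stable isomorphisms on the left. -/
lemma SI.cancel_left {A B C : Rep.{0} k G} {f : A ⟶ B} (h : SI f) {p p' : B ⟶ C}
    (hp : Seq (f ≫ p) (f ≫ p')) : Seq p p' := by
  obtain ⟨f', _, h2⟩ := h
  have a := hp.comp_left f'
  have b := h2.comp_right p
  have c := h2.comp_right p'
  simp only [Category.id_comp, Category.assoc] at a b c
  exact b.symm.trans (a.trans c)

/-- Cancellation of stable isomorphisms on the right. -/
lemma SI.cancel_right {A B C : Rep.{0} k G} {f : B ⟶ C} (h : SI f) {p p' : A ⟶ B}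
    (hp : Seq (p ≫ f) (p' ≫ f)) : Seq p p' := by
  obtain ⟨f', h1, _⟩ := h
  have a := hp.comp_right f'
  have b := h1.comp_left p
  have c := h1.comp_left p'
  simp only [Category.comp_id, Category.assoc] at a b c
  exact b.symm.trans (a.trans c)

/-- `K ⊗ -` is stably faithful. -/
def SFaith (K : Rep.{0} k G) : Prop :=
  ∀ (A B : Rep.{0} k G) (f f' : A ⟶ B), Seq (K ◁ f) (K ◁ f') → Seq f f'

/-- `K ⊗ -` is stably full. -/
def SFull (K : Rep.{0} k G) : Prop :=
  ∀ (A B : Rep.{0} k G) (p : K ⊗ A ⟶ K ⊗ B), ∃ f : A ⟶ B, Seq (K ◁ f) p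

/-- The stable isomorphism `A → K' ⊗ (K ⊗ A)` induced by `1 → K' ⊗ K`. -/
noncomputable def cc {K K' : Rep.{0} k G} (c : 𝟙_ (Rep.{0} k G) ⟶ K' ⊗ K) (A : Rep.{0} k G) :
    A ⟶ K' ⊗ (K ⊗ A) := (λ_ A).inv ≫ (c ▷ A) ≫ (α_ K' K A).hom

lemma cc_nat {K K' : Rep.{0} k G} (c : 𝟙_ (Rep.{0} k G) ⟶ K' ⊗ K) {A B : Rep.{0} k G}
    (f : A ⟶ B) : f ≫ cc c B = cc c A ≫ (K' ◁ (K ◁ f)) := by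
  unfold cc
  rw [leftUnitor_inv_naturality_assoc, whisker_exchange_assoc]
  simp

lemma cc_SI {K K' : Rep.{0} k G} {c : 𝟙_ (Rep.{0} k G) ⟶ K' ⊗ K} (hc : SI c)
    (A : Rep.{0} k G) : SI (cc c A) :=
  (SI.of_isIso _).comp ((hc.whiskerRight A).comp (SI.of_isIso _))

lemma SFaith.of_SI {K K' : Rep.{0} k G} {c : 𝟙_ (Rep.{0} k G) ⟶ K' ⊗ K} (hc : SI c) :
    SFaith K := by
  intro A B f f' h
  apply (cc_SI hc B).cancel_right
  rw [cc_nat, cc_nat]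
  exact (h.whiskerLeft K').comp_left _

lemma SFull.of_SI {K K' : Rep.{0} k G} {c : 𝟙_ (Rep.{0} k G) ⟶ K' ⊗ K} (hc : SI c)
    (hK' : SFaith K') : SFull K := by
  intro A B p
  obtain ⟨d, h1, h2⟩ := cc_SI hc B
  refine ⟨cc c A ≫ (K' ◁ p) ≫ d, ?_⟩
  apply hK'
  apply (cc_SI hc A).cancel_left
  rw [← cc_nat]
  have := h2.comp_left (cc c A ≫ (K' ◁ p))
  simpa using this

lemma SFaith.tensor {K L : Rep.{0} k G} (hK : SFaith K) (hL : SFaith L) : SFaith (K ⊗ L) := by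
  intro A B f f' h
  apply hL
  apply hK
  have := (h.comp_right (α_ K L B).hom).comp_left (α_ K L A).inv
  simpa using this

lemma SFull.tensor {K L : Rep.{0} k G} (hK : SFull K) (hL : SFull L) : SFull (K ⊗ L) := by
  intro A B p
  obtain ⟨q, hq⟩ := hK _ _ ((α_ K L A).inv ≫ p ≫ (α_ K L B).hom)
  obtain ⟨f, hf⟩ := hL _ _ q
  refine ⟨f, ?_⟩
  have := (((hf.whiskerLeft K).trans hq).comp_right (α_ K L B).inv).comp_left (α_ K L A).hom
  simpa using this

lemma SFaith.one : SFaith (𝟙_ (Rep.{0} k G)) := by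
  intro A B f f' h
  have := (h.comp_right (λ_ B).hom).comp_left (λ_ A).inv
  simpa using this

lemma SFull.one : SFull (𝟙_ (Rep.{0} k G)) := by
  intro A B p
  refine ⟨(λ_ A).inv ≫ p ≫ (λ_ B).hom, Seq.of_eq ?_⟩
  simp

end Stable

end Enc

open CategoryTheory MonoidalCategory TensorProduct

namespace Enc
set_option linter.unusedSectionVars false

section Coev
variable (G : Type) [Group G] [Fintype G]

/-- The element `g - h` of the augmentation ideal. -/
noncomputable def dlt (g h : G) : IGcar G :=
  ⟨Finsupp.single g 1 - Finsupp.single h 1, by simp [aug]⟩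

/-- The `g`-th coordinate functional on the augmentation ideal. -/
noncomputable def xi (g : G) : Module.Dual ℤ (IGcar G) :=
  (Finsupp.lapply g).comp (LinearMap.ker (aug G)).subtype

lemma xi_apply (g : G) (v : IGcar G) : xi G g v = v.1 g := rfl

lemma xi_sum (v : IGcar G) : ∑ g, xi G g v = 0 := by
  have h : Finsupp.linearCombination ℤ (fun _ : G => (1 : ℤ)) v.1 = 0 := v.2
  rw [Finsupp.linearCombination_apply, Finsupp.sum_fintype _ _ (by simp)] at h
  simpa [xi] using h

lemma sum_xi_dlt (v : IGcar G) (h : G) : ∑ g, xi G g v • dlt G g h = v := by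
  classical
  apply Subtype.ext
  have h0 := xi_sum G v
  rw [AddSubmonoidClass.coe_finsetSum]
  ext a
  simp only [Finsupp.finsetSum_apply]
  have : ∀ g, ((xi G g v • dlt G g h : IGcar G) : G →₀ ℤ) a
      = (if g = a then xi G g v else 0) - xi G g v * (if h = a then 1 else 0) := by
    intro g
    show xi G g v * ((Finsupp.single g (1:ℤ) - Finsupp.single h 1 : G →₀ ℤ) a) = _
    rw [Finsupp.sub_apply, Finsupp.single_apply, Finsupp.single_apply]
    split_ifs <;> ring
  simp only [this, Finset.sum_sub_distrib, ← Finset.sum_mul, h0]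
  simp [xi_apply]

/-- The coevaluation element, written out. -/
noncomputable def cElt : IGcar G ⊗[ℤ] Module.Dual ℤ (IGcar G) := ∑ g, dlt G g 1 ⊗ₜ[ℤ] xi G g

lemma preElt_eq : preElt G = ∑ g, xi G g ⊗ₜ[ℤ] dlt G g 1 := by
  apply (dualTensorHomEquiv ℤ (IGcar G) (IGcar G)).injective
  rw [preElt, LinearEquiv.apply_symm_apply, map_sum]
  ext1 v
  rw [LinearMap.sum_apply]
  exact (sum_xi_dlt G v 1).symm

lemma coevElt_eq : coevElt G = cElt G := by
  have : TensorProduct.comm ℤ (Module.Dual ℤ (IGcar G)) (IGcar G) (preElt G) = cElt G := by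
    rw [preElt_eq, map_sum, cElt]
    rfl
  exact this

/-- Contraction. -/
noncomputable def ctr : IGcar G ⊗[ℤ] Module.Dual ℤ (IGcar G) →ₗ[ℤ] ℤ :=
  TensorProduct.lift (LinearMap.flip LinearMap.id)

lemma ctr_tmul (v : IGcar G) (φ : Module.Dual ℤ (IGcar G)) : ctr G (v ⊗ₜ φ) = φ v := rfl

lemma ctr_cElt : ctr G (cElt G) = (Fintype.card G : ℤ) - 1 := by
  classical
  rw [cElt, map_sum]
  have : ∀ g, ctr G (dlt G g 1 ⊗ₜ[ℤ] xi G g) = (1 : ℤ) - (if g = 1 then 1 else 0) := by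
    intro g
    rw [ctr_tmul]
    show (Finsupp.single g (1:ℤ) - Finsupp.single 1 1 : G →₀ ℤ) g = _
    rw [Finsupp.sub_apply, Finsupp.single_eq_same, Finsupp.single_apply]
    simp [eq_comm]
  refine (Finset.sum_congr rfl fun g _ => this g).trans ?_
  rw [Finset.sum_sub_distrib]
  simp

/-- The action on the dual. -/
noncomputable def aD (g : G) : Module.Dual ℤ (IGcar G) →ₗ[ℤ] Module.Dual ℤ (IGcar G) :=
  (IGρ G g⁻¹).dualMap

lemma aD_apply (g : G) (φ : Module.Dual ℤ (IGcar G)) (v : IGcar G) :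
    aD G g φ v = φ (IGρ G g⁻¹ v) := rfl

lemma IGρ_dlt (g h k : G) : IGρ G g (dlt G h k) = dlt G (g * h) (g * k) := by
  apply Subtype.ext
  show Finsupp.mapDomain (g • ·) (Finsupp.single h (1:ℤ) - Finsupp.single k 1 : G →₀ ℤ) = _
  rw [sub_eq_add_neg, ← Finsupp.single_neg, Finsupp.mapDomain_add, Finsupp.mapDomain_single,
    Finsupp.mapDomain_single, Finsupp.single_neg, ← sub_eq_add_neg]
  rfl

lemma xi_IGρ (g h : G) (v : IGcar G) : xi G h (IGρ G g v) = xi G (g⁻¹ * h) v := by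
  show Finsupp.mapDomain (g • ·) v.1 h = v.1 (g⁻¹ * h)
  conv_lhs => rw [show h = g • (g⁻¹ * h) by simp]
  rw [Finsupp.mapDomain_apply (MulAction.injective g)]

lemma aD_xi (g h : G) : aD G g (xi G h) = xi G (g * h) := by
  ext1 v
  rw [aD_apply, xi_IGρ, inv_inv]

/-- The homotopy. -/
noncomputable def Hlin : IGcar G ⊗[ℤ] Module.Dual ℤ (IGcar G) →ₗ[ℤ]
    IGcar G ⊗[ℤ] Module.Dual ℤ (IGcar G) :=
  ∑ h, TensorProduct.map ((xi G 1).smulRight (dlt G h 1))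
    ((Module.Dual.eval ℤ (IGcar G) (dlt G 1 h)).smulRight (xi G h))

lemma Hlin_tmul (v : IGcar G) (φ : Module.Dual ℤ (IGcar G)) :
    Hlin G (v ⊗ₜ φ) = ∑ h, (xi G 1 v • dlt G h 1) ⊗ₜ (φ (dlt G 1 h) • xi G h) := by
  rw [Hlin, LinearMap.sum_apply]
  rfl

lemma dlt_eq (g h : G) : dlt G g h = dlt G g 1 - dlt G h 1 := by
  apply Subtype.ext
  show (Finsupp.single g (1:ℤ) - Finsupp.single h 1 : G →₀ ℤ)
    = (Finsupp.single g (1:ℤ) - Finsupp.single 1 1) - (Finsupp.single h (1:ℤ) - Finsupp.single 1 1)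
  abel

lemma sum_xi_smul (φ : Module.Dual ℤ (IGcar G)) : ∑ h, φ (dlt G h 1) • xi G h = φ := by
  ext1 v
  conv_rhs => rw [← sum_xi_dlt G v 1]
  rw [LinearMap.sum_apply, map_sum]
  refine Finset.sum_congr rfl fun g _ => ?_
  rw [map_smul, LinearMap.smul_apply, smul_eq_mul, smul_eq_mul, mul_comm]

lemma sum_xi_zero : ∑ h, xi G h = 0 := by
  ext1 v
  rw [LinearMap.sum_apply, xi_sum]; rfl

lemma homotopy_aux {R V ι : Type} [CommRing R] [AddCommGroup V] [Module R V] [Fintype ι]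
    (c : ι → R) (d : ι → V) (v : V) (φ : Module.Dual R V) (ξ : ι → Module.Dual R V)
    (hc : ∑ g, c g = 0) (hd : ∑ g, c g • d g = v) (hξ : ∑ g, ξ g = 0)
    (hφ : ∑ h, φ (d h) • ξ h = φ) :
    ∑ h, ∑ g, (c g • (d h - d g)) ⊗ₜ[R] (φ (d g - d h) • ξ h)
      = v ⊗ₜ[R] φ + φ v • ∑ h, d h ⊗ₜ[R] ξ h := by
  have e2 : ∀ h, ∑ g, (c g • (d h - d g)) ⊗ₜ[R] (φ (d g - d h) • ξ h)
      = φ v • (d h ⊗ₜ[R] ξ h) + v ⊗ₜ[R] (φ (d h) • ξ h)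
        - (∑ g, (c g * φ (d g)) • d g) ⊗ₜ[R] ξ h := by
    intro h
    have e3 : ∀ g, (c g • (d h - d g)) ⊗ₜ[R] (φ (d g - d h) • ξ h)
      = (φ (c g • d g)) • (d h ⊗ₜ[R] ξ h)
        + (c g • d g) ⊗ₜ[R] (φ (d h) • ξ h)
        - ((c g * φ (d g)) • d g) ⊗ₜ[R] ξ h
        - c g • (φ (d h) • (d h ⊗ₜ[R] ξ h)) := by
      intro g
      simp only [TensorProduct.tmul_smul, ← TensorProduct.smul_tmul', map_sub, map_smul,
        TensorProduct.sub_tmul, smul_eq_mul]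
      module
    rw [Finset.sum_congr rfl fun g _ => e3 g]
    simp only [Finset.sum_add_distrib, Finset.sum_sub_distrib, ← Finset.sum_smul, hc,
      ← TensorProduct.sum_tmul, ← map_sum, hd]
    rw [zero_smul, sub_zero]
  rw [Finset.sum_congr rfl fun g _ => e2 g]
  rw [Finset.sum_sub_distrib, Finset.sum_add_distrib, ← Finset.smul_sum, ← TensorProduct.tmul_sum,
    ← TensorProduct.tmul_sum, hξ, hφ, TensorProduct.tmul_zero, sub_zero, add_comm]

lemma homotopy_tmul (v : IGcar G) (φ : Module.Dual ℤ (IGcar G)) :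
    ∑ g, TensorProduct.map (IGρ G g) (aD G g)
        (Hlin G (TensorProduct.map (IGρ G g⁻¹) (aD G g⁻¹) (v ⊗ₜ φ)))
      = v ⊗ₜ φ + φ v • cElt G := by
  have e1 : ∀ g, TensorProduct.map (IGρ G g) (aD G g)
        (Hlin G (TensorProduct.map (IGρ G g⁻¹) (aD G g⁻¹) (v ⊗ₜ φ)))
      = ∑ h, (xi G g v • (dlt G h 1 - dlt G g 1)) ⊗ₜ (φ (dlt G g 1 - dlt G h 1) • xi G h) := by
    intro g
    rw [TensorProduct.map_tmul, Hlin_tmul, map_sum]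
    rw [← Equiv.sum_comp (Equiv.mulLeft g) (fun h =>
      (xi G g v • (dlt G h 1 - dlt G g 1)) ⊗ₜ[ℤ] (φ (dlt G g 1 - dlt G h 1) • xi G h))]
    refine Finset.sum_congr rfl fun h _ => ?_
    rw [TensorProduct.map_tmul, map_smul, map_smul, IGρ_dlt, aD_xi, xi_IGρ, aD_apply, inv_inv,
      IGρ_dlt, mul_one, dlt_eq G (g * h) g, dlt_eq G g (g * h)]
    rfl
  rw [Finset.sum_congr rfl fun g _ => e1 g, Finset.sum_comm]
  exact homotopy_aux (fun g => xi G g v) (fun g => dlt G g 1) v φ (fun g => xi G g)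
    (xi_sum G v) (sum_xi_dlt G v 1) (sum_xi_zero G) (sum_xi_smul G φ)

lemma homotopy (t : IGcar G ⊗[ℤ] Module.Dual ℤ (IGcar G)) :
    ∑ g, TensorProduct.map (IGρ G g) (aD G g)
        (Hlin G (TensorProduct.map (IGρ G g⁻¹) (aD G g⁻¹) t))
      = t + ctr G t • cElt G := by
  induction t with
  | zero => simp
  | tmul v φ => exact homotopy_tmul G v φ
  | add x y hx hy =>
    simp only [map_add, Finset.sum_add_distrib, hx, hy, add_smul]
    abel

/-- Evaluation `I ⊗ I^∨ ⟶ ℤ`. -/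
noncomputable def evv : IGrep G ⊗ DIG G ⟶ 𝟙_ (Rep ℤ G) := (ihom.ev (IGrep G)).app (𝟙_ (Rep ℤ G))

lemma evv_apply (t : IGcar G ⊗[ℤ] Module.Dual ℤ (IGcar G)) :
    (evv G).hom t = ctr G t := by
  have : (evv G).hom.toLinearMap = ctr G := by
    apply TensorProduct.ext'
    intro x y
    rfl
  exact LinearMap.congr_fun this t

lemma coev_apply (z : ℤ) : (coev G).hom z = z • cElt G :=
  (show (coev G).hom z = z • coevElt G from rfl).trans (congrArg (fun t => z • t) (coevElt_eq G))

lemma sub_neg_smul_aux {R M : Type} [CommRing R] [AddCommGroup M] [Module R M] (s c : M) (r : R) :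
    s - (-r) • c = s + r • c := by
  rw [neg_smul, sub_neg_eq_add]

lemma coev_SI : SI (coev G) := by
  refine ⟨-evv G, ?_, ?_⟩
  · apply Seq.symm
    refine ⟨(LinearMap.id : ℤ →ₗ[ℤ] ℤ), fun z => ?_⟩
    have e1 : (𝟙 (𝟙_ (Rep ℤ G)) - coev G ≫ (-evv G)).hom z
        = (z : ℤ) - (- ((evv G).hom ((coev G).hom z) : ℤ)) := rfl
    have e2 : ((evv G).hom ((coev G).hom z) : ℤ) = (show ℤ from z) * ((Fintype.card G : ℤ) - 1) := by
      refine (congrArg (fun t => (evv G).hom t) (coev_apply G z)).trans ?_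
      refine (evv_apply G _).trans ?_
      rw [map_smul, ctr_cElt, smul_eq_mul]
    refine e1.trans ?_
    refine (congrArg (fun t : ℤ => (z : ℤ) - (-t)) e2).trans ?_
    have e3 : ∀ w : ℤ, w - -(w * ((Fintype.card G : ℤ) - 1)) = ∑ _g : G, w := by
      intro w
      simp only [Finset.sum_const, Finset.card_univ, nsmul_eq_mul]
      ring
    exact e3 z
  · apply Seq.symm
    refine ⟨Hlin G, fun t => ?_⟩
    have e1 : (𝟙 _ - (-evv G) ≫ coev G).hom t
        = t - ((coev G).hom ((-evv G).hom t)) := rfl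
    have e2 : ((coev G).hom ((-evv G).hom t)) = (- ctr G t : ℤ) • cElt G := by
      refine (coev_apply G _).trans ?_
      exact congrArg (fun z : ℤ => (-z) • cElt G) (evv_apply G t)
    refine e1.trans ?_
    refine (congrArg (fun s => t - s) e2).trans ?_
    have e3 : ∀ s : IGcar G ⊗[ℤ] Module.Dual ℤ (IGcar G), s - (- ctr G s : ℤ) • cElt G
        = ∑ g, TensorProduct.map (IGρ G g) (aD G g)
        (Hlin G (TensorProduct.map (IGρ G g⁻¹) (aD G g⁻¹) s)) := by
      intro s
      rw [homotopy]
      exact sub_neg_smul_aux s (cElt G) (ctr G s)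
    exact e3 t

end Coev

section Shift
variable {G : Type} [Group G] [Fintype G]

lemma SI.hom {A B : Rep.{0} ℤ G} (e : A ≅ B) : SI e.hom := SI.of_isIso _
lemma SI.inv {A B : Rep.{0} ℤ G} (e : A ≅ B) : SI e.inv := SI.of_isIso _
lemma SI.eqh {A B : Rep.{0} ℤ G} (e : A = B) : SI (eqToHom e) := SI.of_isIso _

lemma coev_braid_SI : SI (coev G ≫ (β_ (IGrep G) (DIG G)).hom) :=
  (coev_SI G).comp (SI.hom _)

lemma sMap_SI : ∀ n : ℤ, SI (sMap (G := G) n)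
  | .ofNat _ => SI.of_isIso (𝟙 _)
  | .negSucc 0 => (coev_SI G).comp ((SI.hom (β_ (IGrep G) (DIG G))).comp
      ((SI.inv (λ_ (DIG G))).whiskerRight (IGrep G)))
  | .negSucc (m+1) =>
    (SI.inv (ρ_ (Jn G (m+1)))).comp ((coev_braid_SI.whiskerLeft (Jn G (m+1))).comp
      (SI.inv (α_ (Jn G (m+1)) (DIG G) (IGrep G))))

lemma tMap_SI : ∀ n : ℤ, SI (tMap (G := G) n)
  | .ofNat 0 => SI.of_isIso (𝟙 _)
  | .ofNat (m+1) => (SI.eqh _).comp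
    ((SI.inv (ρ_ (Jp G m))).comp (((coev_SI G).whiskerLeft (Jp G m)).comp
      (SI.inv (α_ (Jp G m) (IGrep G) (DIG G)))))
  | .negSucc _ => SI.eqh rfl

lemma μpos_SI (i : ℤ) : ∀ m : ℕ, SI (μpos (G := G) i m)
  | 0 => (SI.eqh _).comp (SI.inv (ρ_ (J G i)))
  | m + 1 => (SI.eqh _).comp ((sMap_SI _).comp
      (((μpos_SI i m).whiskerRight _).comp (SI.hom (α_ (J G i) (J G (m:ℤ)) (IGrep G)))))

lemma μneg_SI (i : ℤ) : ∀ m : ℕ, SI (μneg (G := G) i m)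
  | 0 => (SI.eqh _).comp (SI.inv (ρ_ (J G i)))
  | m + 1 => (SI.eqh _).comp ((tMap_SI _).comp
      (((μneg_SI i m).whiskerRight _).comp ((SI.hom (α_ (J G i) (J G (-(m:ℤ))) (DIG G))).comp
        ((SI.eqh _).whiskerLeft _))))

lemma μ_SI (i : ℤ) : ∀ j : ℤ, SI (μ G i j)
  | .ofNat m => μpos_SI i m
  | .negSucc m => (SI.eqh _).comp (μneg_SI i (m+1))

lemma IG_faith : SFaith (IGrep G) := SFaith.of_SI coev_braid_SI
lemma DIG_faith : SFaith (DIG G) := SFaith.of_SI (coev_SI G)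
lemma IG_full : SFull (IGrep G) := SFull.of_SI coev_braid_SI DIG_faith
lemma DIG_full : SFull (DIG G) := SFull.of_SI (coev_SI G) IG_faith

lemma Jp_ff : ∀ n : ℕ, SFaith (Jp G n) ∧ SFull (Jp G n)
  | 0 => ⟨SFaith.one, SFull.one⟩
  | n + 1 => ⟨(Jp_ff n).1.tensor IG_faith, (Jp_ff n).2.tensor IG_full⟩

lemma Jn_ff : ∀ n : ℕ, SFaith (Jn G n) ∧ SFull (Jn G n)
  | 0 => ⟨SFaith.one, SFull.one⟩
  | n + 1 => ⟨(Jn_ff n).1.tensor DIG_faith, (Jn_ff n).2.tensor DIG_full⟩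

lemma J_ff : ∀ n : ℤ, SFaith (J G n) ∧ SFull (J G n)
  | .ofNat n => Jp_ff n
  | .negSucc n => Jn_ff (n + 1)

/-- Finite free underlying module. -/
def FF {k : Type} [CommRing k] {G : Type} [Group G] (A : Rep.{0} k G) : Prop :=
  Module.Free k A.V ∧ Module.Finite k A.V

lemma FF.tensor {k : Type} [CommRing k] {G : Type} [Group G] {A B : Rep.{0} k G}
    (hA : FF A) (hB : FF B) : FF (A ⊗ B) := by
  obtain ⟨h1, h2⟩ := hA
  obtain ⟨h3, h4⟩ := hB
  exact ⟨inferInstanceAs (Module.Free k (A.V ⊗[k] B.V)),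
    inferInstanceAs (Module.Finite k (A.V ⊗[k] B.V))⟩

lemma FF.one {k : Type} [CommRing k] {G : Type} [Group G] : FF (𝟙_ (Rep.{0} k G)) :=
  ⟨inferInstanceAs (Module.Free k k), inferInstanceAs (Module.Finite k k)⟩

lemma FF.IG : FF (IGrep G) :=
  ⟨inferInstanceAs (Module.Free ℤ (IGcar G)), inferInstanceAs (Module.Finite ℤ (IGcar G))⟩

lemma FF.DIG : FF (DIG G) :=
  ⟨inferInstanceAs (Module.Free ℤ (Module.Dual ℤ (IGcar G))),
    inferInstanceAs (Module.Finite ℤ (Module.Dual ℤ (IGcar G)))⟩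

lemma Jp_free : ∀ n : ℕ, FF (Jp G n)
  | 0 => FF.one
  | n + 1 => (Jp_free n).tensor FF.IG

lemma Jn_free : ∀ n : ℕ, FF (Jn G n)
  | 0 => FF.one
  | n + 1 => (Jn_free n).tensor FF.DIG

lemma J_free : ∀ n : ℤ, FF (J G n)
  | .ofNat n => Jp_free n
  | .negSucc n => Jn_free (n + 1)

end Shift
end Enc

open CategoryTheory MonoidalCategory TensorProduct

namespace Enc
set_option linter.unusedSectionVars false

section Theta
variable {k : Type} [CommRing k] {G : Type} [Group G] [Fintype G]

lemma theta_bij {J X X' : Type} [AddCommGroup J] [Module k J] [AddCommGroup X] [Module k X]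
    [AddCommGroup X'] [Module k X'] [Module.Free k J] [Module.Finite k J]
    (F : J ⊗[k] (X' →ₗ[k] X) →ₗ[k] (X' →ₗ[k] X ⊗[k] J))
    (hF : ∀ j φ x, F (j ⊗ₜ φ) x = φ x ⊗ₜ j) : Function.Bijective F := by
  classical
  let b := Module.Free.chooseBasis k J
  let e1 := TensorProduct.equivFinsuppOfBasisLeft (N := X' →ₗ[k] X) b
  let e2 := TensorProduct.equivFinsuppOfBasisRight (M := X) b
  have key : ∀ t x i, e2 (F t x) i = e1 t i x := by
    intro t x i
    induction t with
    | zero => simp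
    | add p q hp hq => simp [hp, hq]
    | tmul j φ => 
      rw [hF]
      simp [e1, e2]
  constructor
  · rw [injective_iff_map_eq_zero]
    intro t ht
    apply e1.injective
    ext i x
    rw [← key, ht]
    simp
  · intro f
    let p : Module.Free.ChooseBasisIndex k J →₀ (X' →ₗ[k] X) :=
      Finsupp.equivFunOnFinite.symm fun i => (Finsupp.lapply i) ∘ₗ e2.toLinearMap ∘ₗ f
    refine ⟨e1.symm p, ?_⟩
    ext x
    apply e2.injective
    ext i
    rw [key, LinearEquiv.apply_symm_apply]
    rfl

/-- The universal class. -/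
noncomputable def UU (X K : Rep.{0} k G) : K ⟶ (Rep.ihom X).obj (X ⊗ K) :=
  MonoidalClosed.curry (𝟙 (X ⊗ K))

end Theta

section Main
variable {G : Type} [Group G] [Fintype G]

/-- The comparison `K ⊗ Hom(X', X) ⟶ Hom(X', X ⊗ K)`. -/
noncomputable def theta (X X' K : Rep.{0} ℤ G) : K ⊗ hRep X' X ⟶ hRep X' (X ⊗ K) :=
  (UU X K ▷ hRep X' X) ≫ compPair X' X (X ⊗ K)

lemma theta_apply (X X' K : Rep.{0} ℤ G) (j : K.V) (φ : X'.V →ₗ[ℤ] X.V) (x : X'.V) :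
    (show X'.V →ₗ[ℤ] X.V ⊗[ℤ] K.V from (theta X X' K).hom.toLinearMap (j ⊗ₜ[ℤ] φ)) x = (φ x ⊗ₜ[ℤ] j : X.V ⊗[ℤ] K.V) := rfl

lemma theta_SI (X X' K : Rep.{0} ℤ G) (hK : FF K) : SI (theta X X' K) := by
  obtain ⟨h1, h2⟩ := hK
  have hb := theta_bij (k := ℤ) (J := K.V) (X := X.V) (X' := X'.V)
    (theta X X' K).hom.toLinearMap (theta_apply X X' K)
  have : IsIso (theta X X' K) := (ConcreteCategory.isIso_iff_bijective _).2 hb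
  exact SI.of_isIso _

lemma mkCls_surj {n : ℤ} {W : Rep ℤ G} (z : tate n W) : ∃ m : J G n ⟶ W, mkCls m = z := by
  obtain ⟨⟨f, hf⟩, rfl⟩ := Submodule.Quotient.mk_surjective _ z
  change (J G n).V →ₗ[ℤ] W.V at f
  refine ⟨Rep.ofHom ⟨f, fun g => ?_⟩, rfl⟩
  have h : W.ρ g ∘ₗ f ∘ₗ (J G n).ρ g⁻¹ = f := hf g
  apply LinearMap.ext
  intro v
  have := LinearMap.congr_fun h ((J G n).ρ g v)
  refine this.symm.trans ?_
  show W.ρ g (f ((J G n).ρ g⁻¹ ((J G n).ρ g v))) = W.ρ g (f v)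
  exact congrArg (fun w => W.ρ g (f w)) (Representation.inv_self_apply (J G n).ρ g v)

lemma mkCls_eq_iff {n : ℤ} {W : Rep ℤ G} (m m' : J G n ⟶ W) :
    mkCls m = mkCls m' ↔ Seq m m' := by
  refine (Submodule.Quotient.eq _).trans ?_
  constructor
  · rintro ⟨h, hh⟩
    refine ⟨h, fun v => ?_⟩
    have h1 := LinearMap.congr_fun (congrArg Subtype.val hh) v
    refine h1.symm.trans ?_
    have h2 : rnorm ((hRep (J G n) W).ρ) h = ∑ g : G, ((hRep (J G n) W).ρ g) h :=
      LinearMap.sum_apply _ _ _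
    refine (LinearMap.congr_fun h2 v).trans ?_
    exact LinearMap.sum_apply _ _ _
  · rintro ⟨h, hh⟩
    refine ⟨h, ?_⟩
    apply Subtype.ext
    have h2 : rnorm ((hRep (J G n) W).ρ) h = ∑ g : G, ((hRep (J G n) W).ρ g) h :=
      LinearMap.sum_apply _ _ _
    apply LinearMap.ext
    intro v
    refine (LinearMap.congr_fun h2 v).trans ?_
    refine Eq.trans ?_ (hh v).symm
    exact LinearMap.sum_apply _ _ _

lemma tmap_mkCls {n : ℤ} {M N : Rep ℤ G} (φ : M ⟶ N) (m : J G n ⟶ M) :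
    tmap n φ (mkCls m) = mkCls (m ≫ φ) := rfl

lemma ccup_mkCls {i j : ℤ} {X X' A : Rep ℤ G} (f : J G i ⟶ hRep X A) (g : J G j ⟶ hRep X' X) :
    ccup (mkCls f) (mkCls g) = mkCls (μ G i j ≫ (f ⊗ₘ g) ≫ compPair X' X A) := rfl

lemma mkCls_univ {i : ℤ} {X A : Rep ℤ G} (f : J G i ⟶ hRep X A) :
    ∃ φ : X ⊗ J G i ⟶ A, mkCls f = tmap i ((Rep.ihom X).map φ) (mkCls (UU X (J G i))) := by
  refine ⟨MonoidalClosed.uncurry f, ?_⟩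
  rw [tmap_mkCls]
  congr 1

lemma compPair_nat {X X' A B : Rep ℤ G} (φ : A ⟶ B) :
    ((Rep.ihom X).map φ ▷ hRep X' X) ≫ compPair X' X B
      = compPair X' X A ≫ (Rep.ihom X').map φ := by
  apply Rep.hom_ext
  apply Representation.IntertwiningMap.toLinearMap_injective
  apply TensorProduct.ext'
  intro x y
  rfl

lemma ccup_tmap {i j : ℤ} {X X' A B : Rep ℤ G} (φ : A ⟶ B) (z : tate i (hRep X A))
    (x : tate j (hRep X' X)) :
    ccup (tmap i ((Rep.ihom X).map φ) z) x = tmap (i + j) ((Rep.ihom X').map φ) (ccup z x) := by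
  obtain ⟨f, rfl⟩ := mkCls_surj z
  obtain ⟨g, rfl⟩ := mkCls_surj x
  rw [tmap_mkCls, ccup_mkCls, ccup_mkCls, tmap_mkCls]
  congr 1
  rw [Category.assoc, Category.assoc, ← compPair_nat]
  simp only [MonoidalCategory.tensorHom_def', comp_whiskerRight, Category.assoc]

lemma ccup_UU {i j : ℤ} {X X' : Rep ℤ G} (g : J G j ⟶ hRep X' X) :
    ccup (mkCls (UU X (J G i))) (mkCls g)
      = mkCls (μ G i j ≫ (J G i ◁ g) ≫ theta X X' (J G i)) := by
  rw [ccup_mkCls]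
  congr 1
  simp [MonoidalCategory.tensorHom_def', theta]

lemma ccup_UU_bij (i j : ℤ) (X X' : Rep ℤ G) :
    Function.Bijective fun x : tate j (hRep X' X) => ccup (mkCls (UU X (J G i))) x := by
  have hθ := theta_SI X X' (J G i) (J_free i)
  have hμ := μ_SI (G := G) i j
  constructor
  · intro x x' h
    obtain ⟨g, rfl⟩ := mkCls_surj x
    obtain ⟨g', rfl⟩ := mkCls_surj x'
    simp only [ccup_UU] at h
    rw [mkCls_eq_iff] at h ⊢
    exact (J_ff i).1 _ _ _ _ (hθ.cancel_right (hμ.cancel_left h))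
  · intro y
    obtain ⟨p, rfl⟩ := mkCls_surj y
    obtain ⟨θ', t1, t2⟩ := hθ
    obtain ⟨μ', m1, m2⟩ := hμ
    obtain ⟨g, hg⟩ := (J_ff i).2 _ _ (μ' ≫ p ≫ θ')
    refine ⟨mkCls g, ?_⟩
    simp only [ccup_UU]
    rw [mkCls_eq_iff]
    refine ((hg.comp_right _).comp_left _).trans ?_
    have a := m1.comp (t2.comp_left p)
    simpa using a

lemma tcast_bij {i j : ℤ} {M : Rep ℤ G} (h : i = j) :
    Function.Bijective (tcast (M := M) h) := by
  subst h; exact Function.bijective_id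

lemma tcast_tmap {i j : ℤ} {M N : Rep ℤ G} (h : i = j) (φ : M ⟶ N) (z : tate i M) :
    tcast h (tmap i φ z) = tmap j φ (tcast h z) := by
  subst h; rfl

lemma ccupTo_tmap {i j m : ℤ} {X X' A B : Rep ℤ G} (φ : A ⟶ B) (z : tate i (hRep X A))
    (x : tate j (hRep X' X)) (h : i + j = m) :
    ccupTo (tmap i ((Rep.ihom X).map φ) z) x h
      = tmap m ((Rep.ihom X').map φ) (ccupTo z x h) := by
  unfold ccupTo
  rw [ccup_tmap, tcast_tmap]

end Main

end Enc

open CategoryTheory MonoidalCategory Enc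

theorem statement4 (G : Type) [Group G] [Fintype G] (X X' : Rep ℤ G) (r s : ℤ)
    (Φ : ∀ A : Rep ℤ G, tate s (hRep X A) →+ tate (r + s) (hRep X' A))
    (hΦ : ∀ {A B : Rep ℤ G} (φ : A ⟶ B) (z : tate s (hRep X A)),
        Φ B (tmap s ((Rep.ihom X).map φ) z) = tmap (r + s) ((Rep.ihom X').map φ) (Φ A z)) :
    ∃! x : tate r (hRep X' X), ∀ (A : Rep ℤ G) (z : tate s (hRep X A)),
      Φ A z = ccupTo z x (add_comm s r) := by
  have hb : Function.Bijective fun x : tate r (hRep X' X) =>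
      ccupTo (mkCls (UU X (J G s))) x (add_comm s r) :=
    (tcast_bij (add_comm s r)).comp (ccup_UU_bij s r X X')
  obtain ⟨x, hx⟩ := hb.2 (Φ _ (mkCls (UU X (J G s))))
  refine ⟨x, fun A z => ?_, fun x' hx' => ?_⟩
  · obtain ⟨f, rfl⟩ := mkCls_surj z
    obtain ⟨φ, hφ⟩ := mkCls_univ f
    rw [hφ, hΦ, ccupTo_tmap]
    exact congrArg _ hx.symm
  · apply hb.1
    exact (hx' _ _).symm.trans hx.symm
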